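/- Over the 3-periodic billiard family, the orthocenter X₄† of the focus-inversive triangle lies on the circle with center C₄† = (c(−1 + ρ²(b² + δ)δ/(a²b⁴)), 0) and radius R₄† = ρ² c²(b² + δ)/(ab⁴). -/

import Mathlib

noncomputable section

namespace BilliardInv

/-- A point of the plane. -/
abbrev Pt := ℝ × ℝ

/-- Euclidean dot product. -/
def dot (p q : Pt) : ℝ := p.1 * q.1 + p.2 * q.2

/-- Euclidean distance. -/
def dst (p q : Pt) : ℝ := Real.sqrt ((p.1 - q.1) ^ 2 + (p.2 - q.2) ^ 2)

/-- Membership in the ellipse x²/a² + y²/b² = 1. -/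
def onEllipse (a b : ℝ) (p : Pt) : Prop := p.1 ^ 2 / a ^ 2 + p.2 ^ 2 / b ^ 2 = 1

/-- Half the gradient of f(x,y) = x²/a² + y²/b² (an outward normal direction). -/
def nrm (a b : ℝ) (p : Pt) : Pt := (p.1 / a ^ 2, p.2 / b ^ 2)

/-- Unit vector pointing from `v` toward `q`. -/
def udir (v q : Pt) : Pt := (dst v q)⁻¹ • (q - v)

/-- The billiard reflection law at vertex `v` with neighboring vertices `q`, `r`:
the two adjacent sides make equal angles with the ellipse normal at `v`. -/
def reflectAt (a b : ℝ) (q v r : Pt) : Prop :=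
  dot (udir v q) (nrm a b v) = dot (udir v r) (nrm a b v)

/-- A 3-periodic billiard orbit in the ellipse with semi-axes `a > b > 0`:
a nondegenerate triangle inscribed in the ellipse obeying the reflection
law at each vertex. -/
structure Orbit3 (a b : ℝ) : Type where
  P1 : Pt
  P2 : Pt
  P3 : Pt
  h1 : onEllipse a b P1
  h2 : onEllipse a b P2
  h3 : onEllipse a b P3
  d12 : P1 ≠ P2
  d23 : P2 ≠ P3
  d31 : P3 ≠ P1
  r1 : reflectAt a b P3 P1 P2
  r2 : reflectAt a b P1 P2 P3
  r3 : reflectAt a b P2 P3 P1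

/-- Inversion of `p` with respect to the circle of radius `ρ` centered at `f`. -/
def inva (ρ : ℝ) (f p : Pt) : Pt :=
  f + (ρ ^ 2 / ((p.1 - f.1) ^ 2 + (p.2 - f.2) ^ 2)) • (p - f)

/-- Unsigned area of a triangle. -/
def area (A B C : Pt) : ℝ :=
  |(B.1 - A.1) * (C.2 - A.2) - (B.2 - A.2) * (C.1 - A.1)| / 2

/-- The point with barycentric coordinates wA : wB : wC w.r.t. triangle ABC. -/
def bary (wA wB wC : ℝ) (A B C : Pt) : Pt :=
  (wA + wB + wC)⁻¹ • (wA • A + wB • B + wC • C)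

/-- Side length a = |BC|. -/
def sA (A B C : Pt) : ℝ := dst B C
/-- Side length b = |CA|. -/
def sB (A B C : Pt) : ℝ := dst C A
/-- Side length c = |AB|. -/
def sC (A B C : Pt) : ℝ := dst A B

/-- Incenter X(1). -/
def incenter (A B C : Pt) : Pt := bary (sA A B C) (sB A B C) (sC A B C) A B C

/-- Barycenter (centroid) X(2). -/
def centroid (A B C : Pt) : Pt := bary 1 1 1 A B C

/-- Circumcenter X(3), via its barycentric coordinates a²(b²+c²−a²) : · : ·. -/
def circumcenter (A B C : Pt) : Pt :=
  bary (sA A B C ^ 2 * (sB A B C ^ 2 + sC A B C ^ 2 - sA A B C ^ 2))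
       (sB A B C ^ 2 * (sC A B C ^ 2 + sA A B C ^ 2 - sB A B C ^ 2))
       (sC A B C ^ 2 * (sA A B C ^ 2 + sB A B C ^ 2 - sC A B C ^ 2)) A B C

/-- Orthocenter X(4) = A + B + C − 2·(circumcenter). -/
def orthocenter (A B C : Pt) : Pt := A + B + C - (2 : ℝ) • circumcenter A B C

/-- Nine-point center X(5): midpoint of circumcenter and orthocenter. -/
def ninePointCenter (A B C : Pt) : Pt :=
  ((1 : ℝ) / 2) • (circumcenter A B C + orthocenter A B C)

/-- Gergonne point X(7), barycentrics 1/(b+c−a) : 1/(c+a−b) : 1/(a+b−c). -/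
def gergonne (A B C : Pt) : Pt :=
  bary (sB A B C + sC A B C - sA A B C)⁻¹
       (sC A B C + sA A B C - sB A B C)⁻¹
       (sA A B C + sB A B C - sC A B C)⁻¹ A B C

/-- Mittenpunkt X(9), barycentrics a(b+c−a) : b(c+a−b) : c(a+b−c). -/
def mittenpunkt (A B C : Pt) : Pt :=
  bary (sA A B C * (sB A B C + sC A B C - sA A B C))
       (sB A B C * (sC A B C + sA A B C - sB A B C))
       (sC A B C * (sA A B C + sB A B C - sC A B C)) A B C

/-- Feuerbach point X(11), barycentrics (b+c−a)(b−c)² : · : ·. -/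
def feuerbach (A B C : Pt) : Pt :=
  bary ((sB A B C + sC A B C - sA A B C) * (sB A B C - sC A B C) ^ 2)
       ((sC A B C + sA A B C - sB A B C) * (sC A B C - sA A B C) ^ 2)
       ((sA A B C + sB A B C - sC A B C) * (sA A B C - sB A B C) ^ 2) A B C

/-- Triangle center X(100), barycentrics a/(b−c) : b/(c−a) : c/(a−b). -/
def X100 (A B C : Pt) : Pt :=
  bary (sA A B C / (sB A B C - sC A B C))
       (sB A B C / (sC A B C - sA A B C))
       (sC A B C / (sA A B C - sB A B C)) A B C

/-- Orthogonal projection of `Q` onto the line through `A` and `B`. -/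
def projLine (Q A B : Pt) : Pt :=
  A + (dot (Q - A) (B - A) / dot (B - A) (B - A)) • (B - A)

/-- Unsigned area of the pedal triangle of `Q` w.r.t. triangle `A B C`. -/
def pedalArea (Q A B C : Pt) : ℝ :=
  area (projLine Q A B) (projLine Q B C) (projLine Q C A)

end BilliardInv

open BilliardInv Real

/-- Chord relation in eccentric-angle coordinates. -/
lemma chord_rel {a b G x y x' y' : ℝ} (h : x ^ 2 + y ^ 2 = 1) (h' : x' ^ 2 + y' ^ 2 = 1)
    (hne : 1 - x * x' - y * y' ≠ 0)
    (hG : (1 - x * x' - y * y') ^ 2 = G * (a ^ 2 * (x - x') ^ 2 + b ^ 2 * (y - y') ^ 2)) :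
    1 - x * x' - y * y' = G * (a ^ 2 + b ^ 2 - (a ^ 2 - b ^ 2) * (x * x' - y * y')) := by
  apply mul_left_cancel₀ hne
  have key : a ^ 2 * (x - x') ^ 2 + b ^ 2 * (y - y') ^ 2
      = (1 - x * x' - y * y') * (a ^ 2 + b ^ 2 - (a ^ 2 - b ^ 2) * (x * x' - y * y')) := by
    have hy : y ^ 2 = 1 - x ^ 2 := by linarith
    have hy' : y' ^ 2 = 1 - x' ^ 2 := by linarith
    have hyy : (y * y') ^ 2 = (1 - x ^ 2) * (1 - x' ^ 2) := by rw [mul_pow, hy, hy']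
    linear_combination (b ^ 2) * hy + b ^ 2 * hy' + (a ^ 2 - b ^ 2) * hyy
  rw [key] at hG
  linear_combination hG

lemma complex_core {g K : ℂ} {z1 z2 z3 : ℂ} (h12 : z1 ≠ z2) (h23 : z2 ≠ z3) (h31 : z3 ≠ z1)
    (r12 : z1 ^ 2 + z2 ^ 2 = 2 * K * z1 * z2 + g * (z1 ^ 2 * z2 ^ 2 + 1))
    (r23 : z2 ^ 2 + z3 ^ 2 = 2 * K * z2 * z3 + g * (z2 ^ 2 * z3 ^ 2 + 1))
    (r31 : z3 ^ 2 + z1 ^ 2 = 2 * K * z3 * z1 + g * (z3 ^ 2 * z1 ^ 2 + 1)) :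
    g * (z1 * z2 + z2 * z3 + z3 * z1) = -(1 + 2 * K) ∧
    z1 + z2 + z3 = - g * (z1 * z2 * z3) := by
  have A1 : (z2 + z3) * (1 - g * z1 ^ 2) = 2 * K * z1 := by
    apply mul_left_cancel₀ (sub_ne_zero.2 h23)
    linear_combination r12 - r31
  have A2 : (z1 + z3) * (1 - g * z2 ^ 2) = 2 * K * z2 := by
    apply mul_left_cancel₀ (sub_ne_zero.2 h31)
    linear_combination r23 - r12
  have B : g * (z1 * z2 + z2 * z3 + z3 * z1) = -(1 + 2 * K) := by
    apply mul_left_cancel₀ (sub_ne_zero.2 h12)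
    linear_combination A2 - A1
  exact ⟨B, by linear_combination A1 + z1 * B⟩

/-- Symmetric functions of the vertices. -/
lemma real_core {g K x1 y1 x2 y2 x3 y3 : ℝ}
    (c1 : x1 ^ 2 + y1 ^ 2 = 1) (c2 : x2 ^ 2 + y2 ^ 2 = 1) (c3 : x3 ^ 2 + y3 ^ 2 = 1)
    (h12 : ¬ (x1 = x2 ∧ y1 = y2)) (h23 : ¬ (x2 = x3 ∧ y2 = y3)) (h31 : ¬ (x3 = x1 ∧ y3 = y1))
    (r12 : (1 - g) * (x1 * x2) + (1 + g) * (y1 * y2) = K)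
    (r23 : (1 - g) * (x2 * x3) + (1 + g) * (y2 * y3) = K)
    (r31 : (1 - g) * (x3 * x1) + (1 + g) * (y3 * y1) = K) :
    ∃ u v : ℝ, u ^ 2 + v ^ 2 = 1 ∧
      u = x1 * x2 * x3 - x1 * y2 * y3 - x2 * y1 * y3 - x3 * y1 * y2 ∧
      v = y1 * x2 * x3 + y2 * x1 * x3 + y3 * x1 * x2 - y1 * y2 * y3 ∧
      x1 + x2 + x3 = - g * u ∧ y1 + y2 + y3 = - g * v ∧
      x1 * x2 + x2 * x3 + x3 * x1 - (y1 * y2 + y2 * y3 + y3 * y1) = - g ∧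
      x1 * y2 + x2 * y1 + x2 * y3 + x3 * y2 + x3 * y1 + x1 * y3 = 0 ∧
      2 * K = g ^ 2 - 1 := by
  have pr : ∀ {x y x' y' : ℝ}, x ^ 2 + y ^ 2 = 1 → x' ^ 2 + y' ^ 2 = 1 →
      (1 - g) * (x * x') + (1 + g) * (y * y') = K →
      (⟨x, y⟩ : ℂ) ^ 2 + (⟨x', y'⟩ : ℂ) ^ 2 = 2 * (K : ℂ) * ⟨x, y⟩ * ⟨x', y'⟩
        + (g : ℂ) * ((⟨x, y⟩ : ℂ) ^ 2 * (⟨x', y'⟩ : ℂ) ^ 2 + 1) := by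
    intro x y x' y' h h' r
    have e : ∀ s t : ℝ, (⟨s, t⟩ : ℂ) = (s : ℂ) + t * Complex.I := fun s t => by
      apply Complex.ext <;> simp
    have hc : (x : ℂ) ^ 2 + (y : ℂ) ^ 2 = 1 := by exact_mod_cast h
    have hc' : (x' : ℂ) ^ 2 + (y' : ℂ) ^ 2 = 1 := by exact_mod_cast h'
    have rc : (1 - g) * ((x : ℂ) * x') + (1 + g) * ((y : ℂ) * y') = (K : ℂ) := by exact_mod_cast r
    have n : ((x : ℂ) + y * Complex.I) * (x - y * Complex.I) = 1 := by
      linear_combination hc - (y : ℂ) ^ 2 * Complex.I_sq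
    have n' : ((x' : ℂ) + y' * Complex.I) * (x' - y' * Complex.I) = 1 := by
      linear_combination hc' - (y' : ℂ) ^ 2 * Complex.I_sq
    rw [e, e]
    obtain ⟨z, hz⟩ : ∃ z : ℂ, z = (x : ℂ) + y * Complex.I := ⟨_, rfl⟩
    obtain ⟨w, hw⟩ : ∃ z : ℂ, z = (x : ℂ) - y * Complex.I := ⟨_, rfl⟩
    obtain ⟨z', hz'⟩ : ∃ z : ℂ, z = (x' : ℂ) + y' * Complex.I := ⟨_, rfl⟩
    obtain ⟨w', hw'⟩ : ∃ z : ℂ, z = (x' : ℂ) - y' * Complex.I := ⟨_, rfl⟩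
    rw [← hz, ← hz'] 
    rw [← hz, ← hw] at n
    rw [← hz', ← hw'] at n'
    have rr : z * w' + w * z' = 2 * K + g * (z * z' + w * w') := by
      rw [hz, hw, hz', hw', ← rc]
      linear_combination (-2 * (1 + (g : ℂ)) * y * y') * Complex.I_sq
    linear_combination z * z' * rr - z ^ 2 * n' - z' ^ 2 * n + (g : ℂ) * (z * w * n' + n)
  have ne : ∀ {x y x' y' : ℝ}, ¬ (x = x' ∧ y = y') → (⟨x, y⟩ : ℂ) ≠ ⟨x', y'⟩ := by
    intro x y x' y' h e
    exact h ⟨congrArg Complex.re e, congrArg Complex.im e⟩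
  obtain ⟨B, E⟩ := complex_core (ne h12) (ne h23) (ne h31) (pr c1 c2 r12) (pr c2 c3 r23)
    (pr c3 c1 r31)
  have Bre := congrArg Complex.re B
  have Bim := congrArg Complex.im B
  have Ere := congrArg Complex.re E
  have Eim := congrArg Complex.im E
  simp at Bre Bim Ere Eim
  obtain ⟨u, hu⟩ : ∃ u, u = x1 * x2 * x3 - x1 * y2 * y3 - x2 * y1 * y3 - x3 * y1 * y2 := ⟨_, rfl⟩
  obtain ⟨v, hv⟩ : ∃ v, v = y1 * x2 * x3 + y2 * x1 * x3 + y3 * x1 * x2 - y1 * y2 * y3 := ⟨_, rfl⟩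
  have huv : u ^ 2 + v ^ 2 = 1 := by
    have : u ^ 2 + v ^ 2 = (x1 ^ 2 + y1 ^ 2) * (x2 ^ 2 + y2 ^ 2) * (x3 ^ 2 + y3 ^ 2) := by
      rw [hu, hv]; ring
    rw [this, c1, c2, c3]; norm_num
  have E1 : x1 + x2 + x3 = - g * u := by rw [hu]; linarith
  have F1 : y1 + y2 + y3 = - g * v := by rw [hv]; linarith
  -- e2 = conj e1 * e3
  have E2 : x1 * x2 + x2 * x3 + x3 * x1 - (y1 * y2 + y2 * y3 + y3 * y1) = - g := by
    have : x1 * x2 + x2 * x3 + x3 * x1 - (y1 * y2 + y2 * y3 + y3 * y1)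
        = (x1 + x2 + x3) * u + (y1 + y2 + y3) * v := by
      rw [hu, hv]
      linear_combination (-(x2 * x3 - y2 * y3)) * c1 - (x1 * x3 - y1 * y3) * c2
        - (x1 * x2 - y1 * y2) * c3
    rw [this, E1, F1]; linear_combination (-g) * huv
  have F2 : x1 * y2 + x2 * y1 + x2 * y3 + x3 * y2 + x3 * y1 + x1 * y3 = 0 := by
    have : x1 * y2 + x2 * y1 + x2 * y3 + x3 * y2 + x3 * y1 + x1 * y3
        = (x1 + x2 + x3) * v - (y1 + y2 + y3) * u := by
      rw [hu, hv]
      linear_combination (-(x2 * y3 + y2 * x3)) * c1 - (x1 * y3 + y1 * x3) * c2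
        - (x1 * y2 + y1 * x2) * c3
    rw [this, E1, F1]; ring
  refine ⟨u, v, huv, hu, hv, E1, F1, E2, F2, ?_⟩
  linear_combination Bre - g * E2

lemma det_ne_zero_aux {px py qx qy ox oy : ℝ} (hp : ¬ (px = 0 ∧ py = 0)) (hq : ¬ (qx = 0 ∧ qy = 0))
    (hpq : ¬ (px = qx ∧ py = qy))
    (e1 : px ^ 2 + py ^ 2 = 2 * (px * ox + py * oy))
    (e2 : qx ^ 2 + qy ^ 2 = 2 * (qx * ox + qy * oy)) : px * qy - py * qx ≠ 0 := by
  intro h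
  have pp : px ^ 2 + py ^ 2 ≠ 0 := fun h0 => hp ⟨by nlinarith, by nlinarith⟩
  have qq : qx ^ 2 + qy ^ 2 ≠ 0 := fun h0 => hq ⟨by nlinarith, by nlinarith⟩
  have a1 : qx ^ 2 + qy ^ 2 = px * qx + py * qy := by
    apply mul_left_cancel₀ pp
    linear_combination (px ^ 2 + py ^ 2) * e2 - (px * qx + py * qy) * e1
      + 2 * (px * oy - py * ox) * h
  have a2 : px ^ 2 + py ^ 2 = px * qx + py * qy := by
    apply mul_left_cancel₀ qq
    linear_combination (qx ^ 2 + qy ^ 2) * e1 - (px * qx + py * qy) * e2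
      - 2 * (qx * oy - qy * ox) * h
  have : (px - qx) ^ 2 + (py - qy) ^ 2 = 0 := by linear_combination a1 + a2
  exact hpq ⟨by nlinarith [sq_nonneg (px - qx), sq_nonneg (py - qy)],
    by nlinarith [sq_nonneg (px - qx), sq_nonneg (py - qy)]⟩

lemma dst_sq (p q : Pt) : dst p q ^ 2 = (p.1 - q.1) ^ 2 + (p.2 - q.2) ^ 2 := by
  unfold dst; rw [Real.sq_sqrt (by positivity)]

lemma circumcenter_eq {A B C : Pt} {ox oy k : ℝ} (hAB : A ≠ B) (hBC : B ≠ C) (hCA : C ≠ A)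
    (hA : A.1 ^ 2 + A.2 ^ 2 - 2 * (A.1 * ox + A.2 * oy) = k)
    (hB : B.1 ^ 2 + B.2 ^ 2 - 2 * (B.1 * ox + B.2 * oy) = k)
    (hC : C.1 ^ 2 + C.2 ^ 2 - 2 * (C.1 * ox + C.2 * oy) = k) :
    circumcenter A B C = (ox, oy) := by
  obtain ⟨ax, ay⟩ := A
  obtain ⟨bx, bY⟩ := B
  obtain ⟨cx, cy⟩ := C
  simp only [ne_eq, Prod.mk.injEq] at *
  have eB : (bx - ax) ^ 2 + (bY - ay) ^ 2
      = 2 * ((bx - ax) * (ox - ax) + (bY - ay) * (oy - ay)) := by linear_combination hB - hA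
  have eC : (cx - ax) ^ 2 + (cy - ay) ^ 2
      = 2 * ((cx - ax) * (ox - ax) + (cy - ay) * (oy - ay)) := by linear_combination hC - hA
  have hd := det_ne_zero_aux (px := bx - ax) (py := bY - ay) (qx := cx - ax) (qy := cy - ay)
    (fun h => hAB ⟨by linarith [h.1], by linarith [h.2]⟩)
    (fun h => hCA ⟨by linarith [h.1], by linarith [h.2]⟩)
    (fun h => hBC ⟨by linarith [h.1], by linarith [h.2]⟩) eB eC
  unfold circumcenter bary sA sB sC
  simp only [dst_sq]
  have hW : ((bx - cx) ^ 2 + (bY - cy) ^ 2) * ((cx - ax) ^ 2 + (cy - ay) ^ 2 + ((ax - bx) ^ 2 + (ay - bY) ^ 2) - ((bx - cx) ^ 2 + (bY - cy) ^ 2))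
      + ((cx - ax) ^ 2 + (cy - ay) ^ 2) * ((ax - bx) ^ 2 + (ay - bY) ^ 2 + ((bx - cx) ^ 2 + (bY - cy) ^ 2) - ((cx - ax) ^ 2 + (cy - ay) ^ 2))
      + ((ax - bx) ^ 2 + (ay - bY) ^ 2) * ((bx - cx) ^ 2 + (bY - cy) ^ 2 + ((cx - ax) ^ 2 + (cy - ay) ^ 2) - ((ax - bx) ^ 2 + (ay - bY) ^ 2))
      = 4 * ((bx - ax) * (cy - ay) - (bY - ay) * (cx - ax)) ^ 2 := by ring
  rw [hW]
  have hW0 : 4 * ((bx - ax) * (cy - ay) - (bY - ay) * (cx - ax)) ^ 2 ≠ 0 := by positivity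
  have s1 : (bx - ax) * (cy - ay) - (bY - ay) * (cx - ax) ≠ 0 := hd
  apply Prod.ext
  · simp only [Prod.smul_mk, Prod.mk_add_mk, smul_eq_mul]
    rw [inv_mul_eq_iff_eq_mul₀ hW0]
    linear_combination (2 * ((bx - ax) * (cy - ay) - (bY - ay) * (cx - ax))) *
      ((cy - ay) * eB - (bY - ay) * eC)
  · simp only [Prod.smul_mk, Prod.mk_add_mk, smul_eq_mul]
    rw [inv_mul_eq_iff_eq_mul₀ hW0]
    linear_combination (2 * ((bx - ax) * (cy - ay) - (bY - ay) * (cx - ax))) *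
      ((bx - ax) * eC - (cx - ax) * eB)

lemma sums_core {g K u v x1 y1 x2 y2 x3 y3 : ℝ} (hg0 : 0 < g) (hg1 : g < 1)
    (r12 : (1 - g) * (x1 * x2) + (1 + g) * (y1 * y2) = K)
    (r23 : (1 - g) * (x2 * x3) + (1 + g) * (y2 * y3) = K)
    (r31 : (1 - g) * (x3 * x1) + (1 + g) * (y3 * y1) = K)
    (hu : u = x1 * x2 * x3 - x1 * y2 * y3 - x2 * y1 * y3 - x3 * y1 * y2)
    (hv : v = y1 * x2 * x3 + y2 * x1 * x3 + y3 * x1 * x2 - y1 * y2 * y3)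
    (E1 : x1 + x2 + x3 = - g * u) (F1 : y1 + y2 + y3 = - g * v)
    (E2 : x1 * x2 + x2 * x3 + x3 * x1 - (y1 * y2 + y2 * y3 + y3 * y1) = - g)
    (F2 : x1 * y2 + x2 * y1 + x2 * y3 + x3 * y2 + x3 * y1 + x1 * y3 = 0)
    (hK : 2 * K = g ^ 2 - 1) :
    x1 * x2 + x2 * x3 + x3 * x1 = (g - 3) * (g + 1) / 4 ∧
    x1 * x2 * x3 = u * (1 + g) ^ 2 / 4 ∧
    y1 * x2 * x3 + y2 * x1 * x3 + y3 * x1 * x2 = v * (1 + g) * (3 - g) / 4 ∧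
    x1 * y1 + x2 * y2 + x3 * y3 = g ^ 2 * u * v := by
  refine ⟨?_, ?_, ?_, ?_⟩
  · linear_combination (r12 + r23 + r31) / 2 + (1 + g) / 2 * E2 + 3 / 4 * hK
  · have h2 : (4 - 2 * g) ≠ 0 := by linarith
    apply mul_left_cancel₀ h2
    linear_combination x3 * r12 + x1 * r23 + x2 * r31 + K * E1 - (1 + g) * hu - g * u / 2 * hK
  · have h2 : (4 + 2 * g) ≠ 0 := by linarith
    apply mul_left_cancel₀ h2
    linear_combination y3 * r12 + y1 * r23 + y2 * r31 + K * F1 - (3 * (1 + g)) * hv - g * v / 2 * hK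
  · linear_combination (x1 + x2 + x3) * F1 - g * v * E1 - F2

/-- Each vertex lies on the conic that inverts to the circumcircle. -/
lemma conic_core {g u v x1 y1 x2 y2 x3 y3 : ℝ}
    (c1 : x1 ^ 2 + y1 ^ 2 = 1)
    (hu : u = x1 * x2 * x3 - x1 * y2 * y3 - x2 * y1 * y3 - x3 * y1 * y2)
    (hv : v = y1 * x2 * x3 + y2 * x1 * x3 + y3 * x1 * x2 - y1 * y2 * y3)
    (E1 : x1 + x2 + x3 = - g * u) (F1 : y1 + y2 + y3 = - g * v)
    (E2 : x1 * x2 + x2 * x3 + x3 * x1 - (y1 * y2 + y2 * y3 + y3 * y1) = - g) :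
    2 * x1 ^ 2 + (g - 1) * u * x1 - (g + 1) * v * y1 - (1 + g) = 0 := by
  have h : u * x1 + v * y1 = x2 * x3 - y2 * y3 := by
    rw [hu, hv]; linear_combination (x2 * x3 - y2 * y3) * c1
  linear_combination x1 * E1 - y1 * F1 - E2 - h + c1

lemma inv_sums {r1 r2 r3 y1 y2 y3 : ℝ} (h1 : r1 ≠ 0) (h2 : r2 ≠ 0) (h3 : r3 ≠ 0) :
    1 / r1 ^ 2 + 1 / r2 ^ 2 + 1 / r3 ^ 2 =
      ((r1 * r2 + r2 * r3 + r3 * r1) / (r1 * r2 * r3)) ^ 2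
        - 2 * (r1 + r2 + r3) / (r1 * r2 * r3) ∧
    y1 / r1 ^ 2 + y2 / r2 ^ 2 + y3 / r3 ^ 2 =
      ((r1 * r2 + r2 * r3 + r3 * r1) / (r1 * r2 * r3)) *
        ((y1 * r2 * r3 + y2 * r1 * r3 + y3 * r1 * r2) / (r1 * r2 * r3))
        - ((r1 + r2 + r3) * (y1 + y2 + y3) - (y1 * r1 + y2 * r2 + y3 * r3)) / (r1 * r2 * r3) ∧
    1 / r1 + 1 / r2 + 1 / r3 = (r1 * r2 + r2 * r3 + r3 * r1) / (r1 * r2 * r3) := by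
  refine ⟨?_, ?_, ?_⟩ <;> field_simp <;> ring

/-- Sum of the inverted points (relative to the focus, unit radius). -/
lemma inv_sum_core {a b c g u v x1 y1 x2 y2 x3 y3 D : ℝ} (ha : 0 < a) (hc : 0 < c)
    (hbc : b ^ 2 = a ^ 2 - c ^ 2)
    (hg0 : 0 < g) (hg1 : g < 1)
    (ea : 4 * g * a ^ 2 = c ^ 2 * (3 - g) * (1 + g))
    (hD : D = 2 * a ^ 3 - c ^ 3 * u * (1 + g)) (hD0 : 0 < D)
    (h1 : a + c * x1 ≠ 0) (h2 : a + c * x2 ≠ 0) (h3 : a + c * x3 ≠ 0)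
    (E1 : x1 + x2 + x3 = - g * u) (F1 : y1 + y2 + y3 = - g * v)
    (F2 : x1 * y2 + x2 * y1 + x2 * y3 + x3 * y2 + x3 * y1 + x1 * y3 = 0)
    (S2 : x1 * x2 + x2 * x3 + x3 * x1 = (g - 3) * (g + 1) / 4)
    (P3 : x1 * x2 * x3 = u * (1 + g) ^ 2 / 4)
    (T : y1 * x2 * x3 + y2 * x1 * x3 + y3 * x1 * x2 = v * (1 + g) * (3 - g) / 4)
    (Q : x1 * y1 + x2 * y2 + x3 * y3 = g ^ 2 * u * v) :
    (a * x1 + c) / (a + c * x1) ^ 2 + (a * x2 + c) / (a + c * x2) ^ 2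
      + (a * x3 + c) / (a + c * x3) ^ 2
      = -2 * (3 - g) / (c * (1 - g) * (1 + g)) + 4 * b ^ 2 * (3 * a - c * g * u) / (c * (1 - g) * D)
    ∧ b * y1 / (a + c * x1) ^ 2 + b * y2 / (a + c * x2) ^ 2 + b * y3 / (a + c * x3) ^ 2
      = 4 * a * b * g * v / ((1 - g) * D) := by
  have hg1' : (1 - g) ≠ 0 := by linarith
  have hg2' : (1 + g) ≠ 0 := by linarith
  have hD1 : D ≠ 0 := hD0.ne'
  obtain ⟨I1, I2, I3⟩ := inv_sums (y1 := b * y1) (y2 := b * y2) (y3 := b * y3) h1 h2 h3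
  have hPi : (a + c * x1) * (a + c * x2) * (a + c * x3) = (1 - g) * D / 2 := by
    rw [hD]
    linear_combination a ^ 2 * c * E1 + a * c ^ 2 * S2 + c ^ 3 * P3 + (a - c * u) / 4 * ea
  have hR : (a + c * x1) * (a + c * x2) + (a + c * x2) * (a + c * x3) + (a + c * x3) * (a + c * x1)
      = 2 * a * g * D / (c ^ 2 * (1 + g)) := by
    rw [hD, eq_div_iff (by positivity)]
    linear_combination c ^ 2 * (1 + g) * (2 * a * c * E1 + c ^ 2 * S2)
      + (c ^ 2 * (1 + g) / 4 - a ^ 2) * ea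
  have hY : (b * y1) * (a + c * x2) * (a + c * x3) + (b * y2) * (a + c * x1) * (a + c * x3)
      + (b * y3) * (a + c * x1) * (a + c * x2) = 0 := by
    linear_combination a ^ 2 * b * F1 + a * b * c * F2 + b * c ^ 2 * T - b * v / 4 * ea
  have hs : 2 * a * g * D / (c ^ 2 * (1 + g)) / ((1 - g) * D / 2)
      = 4 * a * g / (c ^ 2 * (1 + g) * (1 - g)) := by
    field_simp; ring
  rw [hPi, hR, hs] at I1 I3
  rw [hPi, hR, hs, hY] at I2
  constructor
  · have e : ∀ x, a + c * x ≠ 0 → (a * x + c) / (a + c * x) ^ 2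
        = (a * (1 / (a + c * x)) - b ^ 2 * (1 / (a + c * x) ^ 2)) / c := by
      intro x hx
      rw [hbc]; field_simp; ring
    rw [e _ h1, e _ h2, e _ h3]
    have e2 : (a * (1 / (a + c * x1)) - b ^ 2 * (1 / (a + c * x1) ^ 2)) / c
      + (a * (1 / (a + c * x2)) - b ^ 2 * (1 / (a + c * x2) ^ 2)) / c
      + (a * (1 / (a + c * x3)) - b ^ 2 * (1 / (a + c * x3) ^ 2)) / c
      = (a * (1 / (a + c * x1) + 1 / (a + c * x2) + 1 / (a + c * x3))
        - b ^ 2 * (1 / (a + c * x1) ^ 2 + 1 / (a + c * x2) ^ 2 + 1 / (a + c * x3) ^ 2)) / c := by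
      ring
    have hsum : a + c * x1 + (a + c * x2) + (a + c * x3) = 3 * a - c * g * u := by
      linear_combination c * E1
    rw [e2, I1, I3, hsum]
    have hb2 : b ^ 2 = c ^ 2 * (3 + g) * (1 - g) / (4 * g) := by
      rw [eq_div_iff (by positivity)]; linear_combination 4 * g * hbc + ea
    have ha2 : a ^ 2 = c ^ 2 * (3 - g) * (1 + g) / (4 * g) := by
      rw [eq_div_iff (by positivity)]; linear_combination ea
    have k1 : a * (4 * a * g / (c ^ 2 * (1 + g) * (1 - g))) = (3 - g) / (1 - g) := by
      have : a * (4 * a * g / (c ^ 2 * (1 + g) * (1 - g))) 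
         = 4 * a ^ 2 * g / (c ^ 2 * (1 + g) * (1 - g)) := by ring
      rw [this, ha2]; field_simp
    have k2 : b ^ 2 * (4 * a * g / (c ^ 2 * (1 + g) * (1 - g))) ^ 2
        = (3 - g) * (3 + g) / ((1 - g) * (1 + g)) := by
      rw [div_pow, mul_pow, mul_pow, ha2, hb2]; field_simp
    rw [mul_sub (b ^ 2), k1, k2]
    field_simp; ring
  · rw [I2]
    have : (a + c * x1 + (a + c * x2) + (a + c * x3)) * (b * y1 + b * y2 + b * y3)
      - (b * y1 * (a + c * x1) + b * y2 * (a + c * x2) + b * y3 * (a + c * x3))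
      = - (2 * a * b * g * v) := by
      linear_combination (2 * a * b + b * c * (x1 + x2 + x3)) * F1 - b * c * g * v * E1 - b * c * Q
    rw [this]; field_simp; ring

/-- The final metric identity. -/
lemma final_core {a b c g u v D δ hx hy : ℝ} (ha : 0 < a) (hb : 0 < b) (hc : 0 < c)
    (hbc : b ^ 2 = a ^ 2 - c ^ 2)
    (hg0 : 0 < g) (hg1 : g < 1)
    (ea : 4 * g * a ^ 2 = c ^ 2 * (3 - g) * (1 + g))
    (hδ : 2 * δ = g * c ^ 2 + a ^ 2 + b ^ 2)
    (huv : u ^ 2 + v ^ 2 = 1)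
    (hD : D = 2 * a ^ 3 - c ^ 3 * u * (1 + g)) (hD0 : 0 < D)
    (hhx : hx = -2 * (3 - g) / (c * (1 - g) * (1 + g))
      + 4 * b ^ 2 * (3 * a - c * g * u) / (c * (1 - g) * D)
      - 2 * (-(a * c ^ 2 * (1 + g)) / (2 * (1 - g) * D) * (4 / c + (1 - g) * u / a)))
    (hhy : hy = 4 * a * b * g * v / ((1 - g) * D)
      - 2 * (-(a * c ^ 2 * (1 + g)) / (2 * (1 - g) * D) * ((1 + g) * v / b))) :
    (hx - c * (b ^ 2 + δ) * δ / (a ^ 2 * b ^ 4)) ^ 2 + hy ^ 2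
      = (c ^ 2 * (b ^ 2 + δ) / (a * b ^ 4)) ^ 2 := by
  have hg1' : (1 - g) ≠ 0 := by linarith
  have hg2' : (1 + g) ≠ 0 := by linarith
  have hg3' : (3 - g) ≠ 0 := by linarith
  have hg4' : (3 + g) ≠ 0 := by linarith
  have hD1 : D ≠ 0 := hD0.ne'
  have hb2 : b ^ 2 = c ^ 2 * (3 + g) * (1 - g) / (4 * g) := by
    rw [eq_div_iff (by positivity)]; linear_combination 4 * g * hbc + ea
  have ha2 : a ^ 2 = c ^ 2 * (3 - g) * (1 + g) / (4 * g) := by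
    rw [eq_div_iff (by positivity)]; linear_combination ea
  have hδ2 : δ = c ^ 2 * (g ^ 2 + 3) / (4 * g) := by
    have : δ = (g * c ^ 2 + a ^ 2 + b ^ 2) / 2 := by linarith
    rw [this, ha2, hb2]; field_simp; ring
  have hbδ : b ^ 2 + δ = c ^ 2 * (3 - g) / (2 * g) := by
    rw [hδ2, hb2]; field_simp; ring
  have hb4 : b ^ 4 = (c ^ 2 * (3 + g) * (1 - g) / (4 * g)) ^ 2 := by rw [← hb2]; ring
  have hR : c ^ 2 * (b ^ 2 + δ) / (a * b ^ 4) = 32 * a * g ^ 2 /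
      (c ^ 2 * (1 + g) * (3 + g) ^ 2 * (1 - g) ^ 2) := by
    have : c ^ 2 * (b ^ 2 + δ) / (a * b ^ 4) = a * (c ^ 2 * (b ^ 2 + δ) / (a ^ 2 * b ^ 4)) := by
      field_simp
    rw [this, hbδ, hb4, ha2]; field_simp; ring
  have hC : c * (b ^ 2 + δ) * δ / (a ^ 2 * b ^ 4) = 8 * g * (g ^ 2 + 3) /
      (c * (1 + g) * (3 + g) ^ 2 * (1 - g) ^ 2) := by
    rw [hbδ, hb4, ha2, hδ2]; field_simp; ring
  have hD2 : D = a * (c ^ 2 * (3 - g) * (1 + g) / (2 * g)) - c ^ 3 * u * (1 + g) := by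
    rw [hD]
    have : a ^ 3 = a * a ^ 2 := by ring
    rw [this, ha2]; field_simp; ring
  have X : hx - 8 * g * (g ^ 2 + 3) / (c * (1 + g) * (3 + g) ^ 2 * (1 - g) ^ 2)
      = 32 * a * g ^ 2 / (c ^ 2 * (1 + g) * (3 + g) ^ 2 * (1 - g) ^ 2)
        * (2 * a ^ 3 * u - c ^ 3 * (1 + g)) / D := by
    have e1 : hx = (-2 * (3 - g) / (c * (1 - g) * (1 + g)) * D
      + 4 * b ^ 2 * (3 * a - c * g * u) / (c * (1 - g))
      + (c * (1 + g)) / (1 - g) * (4 * a + c * (1 - g) * u)) / D := by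
      rw [hhx]; field_simp; ring
    rw [e1, eq_div_iff hD1, sub_mul, div_mul_cancel₀ _ hD1]
    have e2 : 32 * a * g ^ 2 / (c ^ 2 * (1 + g) * (3 + g) ^ 2 * (1 - g) ^ 2)
        * (2 * a ^ 3 * u - c ^ 3 * (1 + g)) = 32 * g ^ 2 / (c ^ 2 * (1 + g) * (3 + g) ^ 2 * (1 - g) ^ 2)
        * (2 * (a ^ 2) ^ 2 * u - a * c ^ 3 * (1 + g)) := by ring
    rw [e2, hD2, hb2, ha2]
    field_simp
    ring
  have Y : hy = 4 * a * c ^ 2 * v / (b * (1 - g) * D) := by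
    have e1 : hy = a * v * (4 * g * b ^ 2 + c ^ 2 * (1 + g) ^ 2) / (b * (1 - g) * D) := by
      rw [hhy]; field_simp; ring
    rw [e1]
    congr 1
    linear_combination a * v * (4 * g * hbc + ea)
  rw [hR, hC, X, Y]
  have Y2 : (4 * a * c ^ 2 * v / (b * (1 - g) * D)) ^ 2
     = (32 * a * g ^ 2 / (c ^ 2 * (1 + g) * (3 + g) ^ 2 * (1 - g) ^ 2)) ^ 2 *
       ((4 * a ^ 6 - c ^ 6 * (1 + g) ^ 2) * v ^ 2) / D ^ 2 := by
    have e : a ^ 6 = (a ^ 2) ^ 3 := by ring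
    rw [e, div_pow, mul_pow, mul_pow, mul_pow, mul_pow, mul_pow, div_pow, mul_pow, mul_pow, ha2, hb2]
    field_simp
    ring
  rw [Y2]
  have hv2 : v ^ 2 = 1 - u ^ 2 := by linarith
  have hZ : (2 * a ^ 3 * u - c ^ 3 * (1 + g)) ^ 2 + (4 * a ^ 6 - c ^ 6 * (1 + g) ^ 2) * v ^ 2
      = D ^ 2 := by
    rw [hv2, hD]; ring
  rw [div_pow, mul_pow, ← add_div, ← mul_add, hZ, mul_div_assoc, div_self (pow_ne_zero 2 hD1), mul_one]

lemma param {a b : ℝ} (ha : 0 < a) (hb : 0 < b) {P : Pt} (h : onEllipse a b P) :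
    ∃ x y : ℝ, P = (a * x, b * y) ∧ x ^ 2 + y ^ 2 = 1 := by
  refine ⟨P.1 / a, P.2 / b, ?_, ?_⟩
  · apply Prod.ext <;> simp <;> field_simp
  · unfold onEllipse at h; rw [div_pow, div_pow]; exact h

lemma refl_eq {a b x y x' y' x'' y'' : ℝ} (ha : 0 < a) (hb : 0 < b) (h0 : x ^ 2 + y ^ 2 = 1)
    (h : reflectAt a b (a * x', b * y') (a * x, b * y) (a * x'', b * y'')) :
    (dst (a * x, b * y) (a * x', b * y'))⁻¹ * (1 - x * x' - y * y')
      = (dst (a * x, b * y) (a * x'', b * y''))⁻¹ * (1 - x * x'' - y * y'') := by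
  unfold reflectAt at h
  have e : ∀ s t : ℝ, dot (udir (a * x, b * y) (a * s, b * t)) (nrm a b (a * x, b * y))
      = - ((dst (a * x, b * y) (a * s, b * t))⁻¹ * (1 - x * s - y * t)) := by
    intro s t
    simp only [dot, udir, nrm, Prod.mk_sub_mk, Prod.smul_mk, smul_eq_mul]
    generalize (dst (a * x, b * y) (a * s, b * t))⁻¹ = d
    have : d * (a * s - a * x) * (a * x / a ^ 2) + d * (b * t - b * y) * (b * y / b ^ 2)
      = d * ((s - x) * x + (t - y) * y) := by field_simp
    rw [this]; linear_combination (-d) * h0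
  rw [e, e] at h
  linarith

lemma dst_comm' (p q : Pt) : dst p q = dst q p := by
  unfold dst; congr 1; ring

lemma sep {x y x' y' : ℝ} (h : x ^ 2 + y ^ 2 = 1) (h' : x' ^ 2 + y' ^ 2 = 1)
    (hne : ¬ (x = x' ∧ y = y')) : 0 < 1 - x * x' - y * y' := by
  have e : 1 - x * x' - y * y' = ((x - x') ^ 2 + (y - y') ^ 2) / 2 := by
    linear_combination (-1 / 2 : ℝ) * h - 1 / 2 * h'
  rw [e]
  by_contra hc
  have h1 := sq_nonneg (x - x')
  have h2 := sq_nonneg (y - y')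
  have e1 : (x - x') ^ 2 = 0 := by linarith
  have e2 : (y - y') ^ 2 = 0 := by linarith
  exact hne ⟨by linarith [pow_eq_zero_iff (two_ne_zero) |>.1 e1],
    by linarith [pow_eq_zero_iff (two_ne_zero) |>.1 e2]⟩

lemma pos_of_ne {a b x y x' y' : ℝ} (ha : 0 < a) (hb : 0 < b) (hne : ¬ (x = x' ∧ y = y')) :
    0 < dst (a * x, b * y) (a * x', b * y') := by
  unfold dst
  apply Real.sqrt_pos.2
  by_contra hc
  have h1 := sq_nonneg (a * x - a * x')
  have h2 := sq_nonneg (b * y - b * y')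
  simp only at hc
  have e1 : (a * x - a * x') ^ 2 = 0 := by linarith
  have e2 : (b * y - b * y') ^ 2 = 0 := by linarith
  have e1' := pow_eq_zero_iff (two_ne_zero) |>.1 e1
  have e2' := pow_eq_zero_iff (two_ne_zero) |>.1 e2
  exact hne ⟨mul_left_cancel₀ ha.ne' (by linarith), mul_left_cancel₀ hb.ne' (by linarith)⟩

lemma inva_eq {a b c ρ x y : ℝ} (hbc : b ^ 2 = a ^ 2 - c ^ 2) (h : x ^ 2 + y ^ 2 = 1) :
    inva ρ (-c, 0) (a * x, b * y) = (-c + ρ ^ 2 * ((a * x + c) / (a + c * x) ^ 2),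
      ρ ^ 2 * (b * y / (a + c * x) ^ 2)) := by
  have e : (a * x - -c) ^ 2 + (b * y - 0) ^ 2 = (a + c * x) ^ 2 := by
    linear_combination y ^ 2 * hbc + (a ^ 2 - c ^ 2) * h
  unfold inva
  simp only [e]
  apply Prod.ext <;> simp <;> ring

lemma inva_ne {a b c ρ x y x' y' : ℝ} (ha : 0 < a) (hb : 0 < b) (hρ : 0 < ρ)
    (hbc : b ^ 2 = a ^ 2 - c ^ 2)
    (h : x ^ 2 + y ^ 2 = 1) (h' : x' ^ 2 + y' ^ 2 = 1)
    (hr : 0 < a + c * x) (hr' : 0 < a + c * x') (hne : ¬ (x = x' ∧ y = y')) :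
    ((-c + ρ ^ 2 * ((a * x + c) / (a + c * x) ^ 2), ρ ^ 2 * (b * y / (a + c * x) ^ 2)) : Pt) ≠
     (-c + ρ ^ 2 * ((a * x' + c) / (a + c * x') ^ 2), ρ ^ 2 * (b * y' / (a + c * x') ^ 2)) := by
  intro heq
  rw [Prod.mk.injEq] at heq
  obtain ⟨e1, e2⟩ := heq
  have e1' : (a * x + c) / (a + c * x) ^ 2 = (a * x' + c) / (a + c * x') ^ 2 :=
    mul_left_cancel₀ (pow_ne_zero 2 hρ.ne') (by linarith)
  have e2' : b * y / (a + c * x) ^ 2 = b * y' / (a + c * x') ^ 2 :=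
    mul_left_cancel₀ (pow_ne_zero 2 hρ.ne') e2
  have n : ∀ s t : ℝ, s ^ 2 + t ^ 2 = 1 → 0 < a + c * s →
      ((a * s + c) / (a + c * s) ^ 2) ^ 2 + (b * t / (a + c * s) ^ 2) ^ 2
        = 1 / (a + c * s) ^ 2 := by
    intro s t hs h0
    have e : (a * s + c) ^ 2 + (b * t) ^ 2 = (a + c * s) ^ 2 := by
      linear_combination t ^ 2 * hbc + (a ^ 2 - c ^ 2) * hs
    rw [div_pow, div_pow, ← add_div, e]
    field_simp
  have n1 := n x y h hr
  have n2 := n x' y' h' hr'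
  rw [e1', e2', n2] at n1
  have hq : (a + c * x') ^ 2 = (a + c * x) ^ 2 := by
    have := congrArg (fun t => t⁻¹) n1
    simpa using this
  rw [hq] at e1' e2'
  have p : (a + c * x) ^ 2 ≠ 0 := by positivity
  have f1 := (div_left_inj' p).1 e1'
  have f2 := (div_left_inj' p).1 e2'
  exact hne ⟨mul_left_cancel₀ ha.ne' (by linarith), mul_left_cancel₀ hb.ne' f2⟩

lemma circ_core {a b c g u v x y D κ : ℝ} (ρ : ℝ) (ha : 0 < a) (hb : 0 < b) (hc : 0 < c)
    (hbc : b ^ 2 = a ^ 2 - c ^ 2)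
    (hg1 : g < 1)
    (ea : 4 * g * a ^ 2 = c ^ 2 * (3 - g) * (1 + g))
    (hD : D = 2 * a ^ 3 - c ^ 3 * u * (1 + g)) (hD0 : 0 < D)
    (hκ : κ = -(a * c ^ 2 * (1 + g)) / (2 * (1 - g) * D))
    (h : x ^ 2 + y ^ 2 = 1) (hr : 0 < a + c * x)
    (hq : 2 * x ^ 2 + (g - 1) * u * x - (g + 1) * v * y - (1 + g) = 0) :
    (-c + ρ ^ 2 * ((a * x + c) / (a + c * x) ^ 2)) ^ 2 + (ρ ^ 2 * (b * y / (a + c * x) ^ 2)) ^ 2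
      - 2 * ((-c + ρ ^ 2 * ((a * x + c) / (a + c * x) ^ 2)) * (-c + ρ ^ 2 * (κ * (4 / c + (1 - g) * u / a)))
        + (ρ ^ 2 * (b * y / (a + c * x) ^ 2)) * (ρ ^ 2 * (κ * ((1 + g) * v / b))))
      = -c ^ 2 + 2 * c * ρ ^ 2 * (κ * (4 / c + (1 - g) * u / a)) - ρ ^ 4 * (4 * κ / c ^ 2) := by
  have hg1' : (1 - g) ≠ 0 := by linarith
  have hD1 : D ≠ 0 := hD0.ne'
  have N : 1 - 2 * c * (κ * (4 / c + (1 - g) * u / a)) + 4 * κ * a ^ 2 / c ^ 2 + 2 * (1 + g) * κ = 0 := by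
    have hk : 2 * (1 - g) * D * κ = -(a * c ^ 2 * (1 + g)) := by
      rw [hκ]; field_simp
    have hk0 : 2 * (1 - g) * D ≠ 0 := mul_ne_zero (mul_ne_zero two_ne_zero hg1') hD1
    apply mul_left_cancel₀ hk0
    have e : 2 * (1 - g) * D * (1 - 2 * c * (κ * (4 / c + (1 - g) * u / a)) + 4 * κ * a ^ 2 / c ^ 2
        + 2 * (1 + g) * κ) = 2 * (1 - g) * D + (2 * (1 - g) * D * κ) *
        (- 2 * c * (4 / c + (1 - g) * u / a) + 4 * a ^ 2 / c ^ 2 + 2 * (1 + g)) := by ring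
    rw [e, hk, hD]
    field_simp
    linear_combination (-2 * a) * ea
  have M : 1 - 2 * ((a * x + c) * (κ * (4 / c + (1 - g) * u / a)) + b * y * (κ * ((1 + g) * v / b)))
      = - (4 * κ / c ^ 2) * (a + c * x) ^ 2 := by
    have e1 : a * x * (κ * (4 / c + (1 - g) * u / a)) = κ * x * (4 * a / c + (1 - g) * u) := by
      field_simp
    have e2 : b * y * (κ * ((1 + g) * v / b)) = κ * y * ((1 + g) * v) := by
      field_simp
    have e3 : 4 * κ / c ^ 2 * (a + c * x) ^ 2
        = 4 * κ * a ^ 2 / c ^ 2 + 2 * κ * x * (4 * a / c) + 4 * κ * x ^ 2 := by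
      field_simp; ring
    linear_combination N - 2 * e1 - 2 * e2 + e3 + 2 * κ * hq
  have e : (a * x + c) ^ 2 + (b * y) ^ 2 = (a + c * x) ^ 2 := by
    linear_combination y ^ 2 * hbc + (a ^ 2 - c ^ 2) * h
  generalize κ * (4 / c + (1 - g) * u / a) = ox at *
  generalize κ * ((1 + g) * v / b) = oy at *
  generalize 4 * κ / c ^ 2 = k at *
  have e' : ((a * x + c) / (a + c * x) ^ 2) ^ 2 + (b * y / (a + c * x) ^ 2) ^ 2
      - 2 * ((a * x + c) / (a + c * x) ^ 2 * ox + (b * y / (a + c * x) ^ 2) * oy) = -k := by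
    rw [div_pow, div_pow, ← add_div, e]
    field_simp
    linear_combination M
  linear_combination ρ ^ 4 * e'

lemma abs_core {a c x y : ℝ} (hc : 0 < c) (hca : c < a) (h : x ^ 2 + y ^ 2 = 1) :
    0 < a + c * x := by
  have : -1 ≤ x := by nlinarith [sq_nonneg y]
  nlinarith

lemma D_pos {a c g u v : ℝ} (hc : 0 < c) (hca : c < a) (hg0 : 0 < g) (hg1 : g < 1)
    (huv : u ^ 2 + v ^ 2 = 1) : 0 < 2 * a ^ 3 - c ^ 3 * u * (1 + g) := by
  have hu1 : u ≤ 1 := by nlinarith [sq_nonneg v]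
  have h3 : c ^ 3 < a ^ 3 := by gcongr
  have hc3 : 0 < c ^ 3 := by positivity
  have h4 : u * (1 + g) ≤ 2 := by
    have : u * (1 + g) ≤ 1 * (1 + g) := mul_le_mul_of_nonneg_right hu1 (by linarith)
    linarith
  have h5 : c ^ 3 * (u * (1 + g)) ≤ c ^ 3 * 2 := mul_le_mul_of_nonneg_left h4 hc3.le
  linarith

set_option maxHeartbeats 1000000 in
/-- over the 3-periodic billiard family, the orthocenter X(4) of the
focus-inversive triangle lies on the stated circle. -/
theorem focus_inversive_orthocenter_circle (a b ρ : ℝ) (hab : a > b) (hb : b > 0)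
    (hρ : ρ > 0) (T : Orbit3 a b) :
    let c : ℝ := Real.sqrt (a ^ 2 - b ^ 2)
    let δ : ℝ := Real.sqrt (a ^ 4 - a ^ 2 * b ^ 2 + b ^ 4)
    let f1 : Pt := (-c, 0)
    let Ctr : Pt := (c * (-1 + ρ ^ 2 * (b ^ 2 + δ) * δ / (a ^ 2 * b ^ 4)), 0)
    dst (orthocenter (inva ρ f1 T.P1) (inva ρ f1 T.P2) (inva ρ f1 T.P3)) Ctr =
      ρ ^ 2 * (a ^ 2 - b ^ 2) * (b ^ 2 + δ) / (a * b ^ 4) := by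
  intro c δ f1 Ctr
  have hb' : 0 < b := hb
  have ha : 0 < a := by linarith
  have hpos : 0 < a ^ 2 - b ^ 2 := by nlinarith
  have hc : 0 < c := Real.sqrt_pos.2 hpos
  have hc2 : c ^ 2 = a ^ 2 - b ^ 2 := Real.sq_sqrt hpos.le
  have hbc : b ^ 2 = a ^ 2 - c ^ 2 := by linarith
  have hca : c < a := by nlinarith
  obtain ⟨P1, P2, P3, h1, h2, h3, d12, d23, d31, r1, r2, r3⟩ := T
  obtain ⟨x1, y1, rfl, c1⟩ := param ha hb' h1
  obtain ⟨x2, y2, rfl, c2⟩ := param ha hb' h2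
  obtain ⟨x3, y3, rfl, c3⟩ := param ha hb' h3
  have n12 : ¬ (x1 = x2 ∧ y1 = y2) := fun h => d12 (by rw [h.1, h.2])
  have n23 : ¬ (x2 = x3 ∧ y2 = y3) := fun h => d23 (by rw [h.1, h.2])
  have n31 : ¬ (x3 = x1 ∧ y3 = y1) := fun h => d31 (by rw [h.1, h.2])
  have p1 := refl_eq ha hb' c1 r1
  have p2 := refl_eq ha hb' c2 r2
  have s12 := sep c1 c2 n12
  have s23 := sep c2 c3 n23
  have s31 := sep c3 c1 n31
  have q12 := pos_of_ne ha hb' n12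
  have q23 := pos_of_ne ha hb' n23
  have q31 := pos_of_ne ha hb' n31
  rw [dst_comm' (a * x1, b * y1) (a * x3, b * y3)] at p1
  rw [dst_comm' (a * x2, b * y2) (a * x1, b * y1)] at p2
  obtain ⟨J, hJ⟩ : ∃ J, J = (dst (a * x1, b * y1) (a * x2, b * y2))⁻¹ * (1 - x1 * x2 - y1 * y2) :=
    ⟨_, rfl⟩
  have hJ0 : 0 < J := by rw [hJ]; positivity
  have sqform : ∀ {x y x' y' : ℝ}, 0 < dst (a * x, b * y) (a * x', b * y') →
      J = (dst (a * x, b * y) (a * x', b * y'))⁻¹ * (1 - x * x' - y * y') →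
      (1 - x * x' - y * y') ^ 2 = J ^ 2 * (a ^ 2 * (x - x') ^ 2 + b ^ 2 * (y - y') ^ 2) := by
    intro x y x' y' hd hj
    have e : a ^ 2 * (x - x') ^ 2 + b ^ 2 * (y - y') ^ 2
        = dst (a * x, b * y) (a * x', b * y') ^ 2 := by
      rw [dst_sq]; ring
    have e2 : 1 - x * x' - y * y' = J * dst (a * x, b * y) (a * x', b * y') := by
      rw [hj, mul_comm _ (dst _ _), mul_inv_cancel_left₀ hd.ne']
    rw [e, e2]; ring
  have j31 : J = (dst (a * x3, b * y3) (a * x1, b * y1))⁻¹ * (1 - x3 * x1 - y3 * y1) := by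
    rw [hJ, ← p1]; ring
  have j23 : J = (dst (a * x2, b * y2) (a * x3, b * y3))⁻¹ * (1 - x2 * x3 - y2 * y3) := by
    rw [hJ, ← p2]; ring
  have t12 := chord_rel c1 c2 s12.ne' (sqform q12 hJ)
  have t23 := chord_rel c2 c3 s23.ne' (sqform q23 j23)
  have t31 := chord_rel c3 c1 s31.ne' (sqform q31 j31)
  obtain ⟨g, hg⟩ : ∃ g, g = J ^ 2 * c ^ 2 := ⟨_, rfl⟩
  have hg0 : 0 < g := by rw [hg]; positivity
  obtain ⟨K, hK⟩ : ∃ K, K = 1 - J ^ 2 * (a ^ 2 + b ^ 2) := ⟨_, rfl⟩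
  rw [← hc2] at t12 t23 t31
  have r12 : (1 - g) * (x1 * x2) + (1 + g) * (y1 * y2) = K := by
    rw [hg, hK]; linear_combination -t12
  have r23 : (1 - g) * (x2 * x3) + (1 + g) * (y2 * y3) = K := by
    rw [hg, hK]; linear_combination -t23
  have r31 : (1 - g) * (x3 * x1) + (1 + g) * (y3 * y1) = K := by
    rw [hg, hK]; linear_combination -t31
  obtain ⟨u, v, huv, hu, hv, E1, F1, E2, F2, hK2⟩ := real_core c1 c2 c3 n12 n23 n31 r12 r23 r31
  have hquad : c ^ 2 * (3 - g ^ 2) = 2 * g * (a ^ 2 + b ^ 2) := by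
    linear_combination c ^ 2 * hK2 - 2 * c ^ 2 * hK - 2 * (a ^ 2 + b ^ 2) * hg
  have ea : 4 * g * a ^ 2 = c ^ 2 * (3 - g) * (1 + g) := by
    linear_combination -hquad - 2 * g * hbc
  have eb : 4 * g * b ^ 2 = c ^ 2 * (3 + g) * (1 - g) := by
    linear_combination ea + 4 * g * hbc
  have hg1 : g < 1 := by
    by_contra hcon
    have : 0 < 4 * g * b ^ 2 := by positivity
    have h2 : 0 ≤ c ^ 2 * (3 + g) * (g - 1) :=
      mul_nonneg (by positivity) (by linarith)
    linarith
  obtain ⟨S2, P3, T3, Q3⟩ := sums_core hg0 hg1 r12 r23 r31 hu hv E1 F1 E2 F2 hK2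
  obtain ⟨D, hD⟩ : ∃ D, D = 2 * a ^ 3 - c ^ 3 * u * (1 + g) := ⟨_, rfl⟩
  have hD0 : 0 < D := by
    rw [hD]; exact D_pos hc hca hg0 hg1 huv
  have R1 := abs_core hc hca c1
  have R2 := abs_core hc hca c2
  have R3 := abs_core hc hca c3
  obtain ⟨κ, hκ⟩ : ∃ κ, κ = -(a * c ^ 2 * (1 + g)) / (2 * (1 - g) * D) := ⟨_, rfl⟩
  have K1 := circ_core ρ ha hb' hc hbc hg1 ea hD hD0 hκ c1 R1 (conic_core c1 hu hv E1 F1 E2)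
  have K2 := circ_core (v := v) ρ ha hb' hc hbc hg1 ea hD hD0 hκ c2 R2
    (conic_core (x2 := x1) (y2 := y1) (x3 := x3) (y3 := y3) c2
      (by rw [hu]; ring) (by rw [hv]; ring) (by linarith) (by linarith) (by linarith))
  have K3 := circ_core (v := v) ρ ha hb' hc hbc hg1 ea hD hD0 hκ c3 R3
    (conic_core (x2 := x1) (y2 := y1) (x3 := x2) (y3 := y2) c3
      (by rw [hu]; ring) (by rw [hv]; ring) (by linarith) (by linarith) (by linarith))
  have hcc := circumcenter_eq (inva_ne ha hb' hρ hbc c1 c2 R1 R2 n12)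
    (inva_ne ha hb' hρ hbc c2 c3 R2 R3 n23) (inva_ne ha hb' hρ hbc c3 c1 R3 R1 n31) K1 K2 K3
  obtain ⟨SX, SY⟩ := inv_sum_core ha hc hbc hg0 hg1 ea hD hD0 R1.ne' R2.ne' R3.ne' E1 F1 F2 S2 P3
    T3 Q3
  have hδ : 2 * δ = g * c ^ 2 + a ^ 2 + b ^ 2 := by
    have e : a ^ 4 - a ^ 2 * b ^ 2 + b ^ 4 = ((g * c ^ 2 + a ^ 2 + b ^ 2) / 2) ^ 2 := by
      have hA : a ^ 2 = b ^ 2 + c ^ 2 := by linarith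
      have e4 : a ^ 4 = (a ^ 2) ^ 2 := by ring
      rw [hA] at hquad
      rw [e4, hA]
      linear_combination c ^ 2 / 4 * hquad
    have : δ = (g * c ^ 2 + a ^ 2 + b ^ 2) / 2 := by
      change Real.sqrt _ = _
      rw [e, Real.sqrt_sq (by positivity)]
    linarith
  have hδ0 : 0 ≤ δ := Real.sqrt_nonneg _
  have F := final_core ha hb' hc hbc hg0 hg1 ea hδ huv hD hD0 rfl rfl
  change dst (orthocenter (inva ρ (-c, 0) (a * x1, b * y1)) (inva ρ (-c, 0) (a * x2, b * y2))
    (inva ρ (-c, 0) (a * x3, b * y3))) (c * (-1 + ρ ^ 2 * (b ^ 2 + δ) * δ / (a ^ 2 * b ^ 4)), 0) = _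
  rw [inva_eq hbc c1, inva_eq hbc c2, inva_eq hbc c3]
  unfold orthocenter
  rw [hcc]
  unfold dst
  simp only [Prod.mk_add_mk, Prod.smul_mk, Prod.mk_sub_mk, smul_eq_mul]
  rw [← hc2]
  have hR0 : 0 ≤ ρ ^ 2 * c ^ 2 * (b ^ 2 + δ) / (a * b ^ 4) := by positivity
  rw [← Real.sqrt_sq hR0]
  congr 1
  rw [← SX, ← SY, ← hκ] at F
  linear_combination ρ ^ 4 * F
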